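/- Let G be a spray on a nonempty open set U ⊆ ℝ^n (n ≥ 2) and dV a volume form on U. Then the Berwald–Weyl curvature of (G,dV) satisfies W^o_k = R_{|k} − ½ R_{·k|m} y^m − (1/(n+1)) χ_{k|m} y^m − (1/(n+1)) W^m_k S_{·m}, where R is the Ricci scalar of G, χ_k its χ-curvature, W^i_k its Weyl curvature, S the S-curvature of (G,dV), and all horizontal covariant derivatives '|' are taken with respect to G. -/

import Mathlib

open scoped BigOperators
open MeasureTheory

noncomputable section BerwaldWeyl

/-- Points/vectors in local coordinates on `ℝⁿ`. -/
abbrev Vec (n : ℕ) := Fin n → ℝ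

/-- Partial derivative in the base (`x`) variable along the `i`-th coordinate. -/
def pdx {n : ℕ} (f : Vec n → Vec n → ℝ) (i : Fin n) : Vec n → Vec n → ℝ :=
  fun x y => fderiv ℝ (fun x' => f x' y) x (Pi.single i 1)

/-- Vertical derivative `f_{·i} = ∂f/∂y^i`. -/
def pdy {n : ℕ} (f : Vec n → Vec n → ℝ) (i : Fin n) : Vec n → Vec n → ℝ :=
  fun x y => fderiv ℝ (fun y' => f x y') y (Pi.single i 1)

/-- The slit fiber `ℝⁿ \ {0}`. -/
def slit (n : ℕ) : Set (Vec n) := {y | y ≠ 0}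

/-- A spray on `U ⊆ ℝⁿ`: a family `G^i(x,y)`, smooth on `U × (ℝⁿ \ {0})` and
positively 2-homogeneous in `y`. -/
def IsSpray {n : ℕ} (U : Set (Vec n)) (G : Fin n → Vec n → Vec n → ℝ) : Prop :=
  (∀ i, ContDiffOn ℝ (⊤ : ℕ∞) (fun p : Vec n × Vec n => G i p.1 p.2) (U ×ˢ slit n)) ∧
  (∀ i, ∀ x ∈ U, ∀ y ∈ slit n, ∀ c : ℝ, 0 < c → G i x (c • y) = c ^ 2 * G i x y)

/-- Nonlinear connection coefficients `N^i_j := ∂G^i/∂y^j`. -/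
def Nc {n : ℕ} (G : Fin n → Vec n → Vec n → ℝ) (i j : Fin n) : Vec n → Vec n → ℝ :=
  pdy (G i) j

/-- Berwald connection coefficients `Γ^i_{jk} := ∂²G^i/∂y^j∂y^k`. -/
def Γc {n : ℕ} (G : Fin n → Vec n → Vec n → ℝ) (i j k : Fin n) : Vec n → Vec n → ℝ :=
  pdy (pdy (G i) j) k

/-- Horizontal derivative of a scalar: `f_{|k} := δf/δx^k = ∂f/∂x^k - N^l_k ∂f/∂y^l`. -/
def hD {n : ℕ} (G : Fin n → Vec n → Vec n → ℝ) (f : Vec n → Vec n → ℝ) (k : Fin n) :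
    Vec n → Vec n → ℝ :=
  fun x y => pdx f k x y - ∑ l, Nc G l k x y * pdy f l x y

/-- Horizontal covariant derivative `A_{j|m}` of a 1-form `A_j`. -/
def covD1 {n : ℕ} (G : Fin n → Vec n → Vec n → ℝ) (A : Fin n → Vec n → Vec n → ℝ)
    (j m : Fin n) : Vec n → Vec n → ℝ :=
  fun x y => hD G (A j) m x y - ∑ l, A l x y * Γc G l j m x y

/-- Horizontal covariant derivative `A^i_{j|m}` of a (1,1)-tensor `A^i_j`. -/
def covD11 {n : ℕ} (G : Fin n → Vec n → Vec n → ℝ)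
    (A : Fin n → Fin n → Vec n → Vec n → ℝ) (i j m : Fin n) : Vec n → Vec n → ℝ :=
  fun x y => hD G (A i j) m x y + ∑ l, A l j x y * Γc G i l m x y
    - ∑ l, A i l x y * Γc G l j m x y

/-- Horizontal covariant derivative `B^i_{jk|m}` of a (1,2)-tensor `B^i_{jk}`. -/
def covD12 {n : ℕ} (G : Fin n → Vec n → Vec n → ℝ)
    (B : Fin n → Fin n → Fin n → Vec n → Vec n → ℝ) (i j k m : Fin n) : Vec n → Vec n → ℝ :=
  fun x y => hD G (B i j k) m x y + ∑ l, B l j k x y * Γc G i l m x y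
    - ∑ l, B i l k x y * Γc G l j m x y - ∑ l, B i j l x y * Γc G l k m x y

/-- Riemann curvature `R^i_k`. -/
def Riem {n : ℕ} (G : Fin n → Vec n → Vec n → ℝ) (i k : Fin n) : Vec n → Vec n → ℝ :=
  fun x y => 2 * pdx (G i) k x y - ∑ j, y j * pdy (pdx (G i) j) k x y
    + 2 * ∑ j, G j x y * Γc G i j k x y - ∑ s, Nc G i s x y * Nc G s k x y

/-- Ricci scalar `R := R^m_m/(n-1)`. -/
def Ricci {n : ℕ} (G : Fin n → Vec n → Vec n → ℝ) : Vec n → Vec n → ℝ :=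
  fun x y => (∑ m, Riem G m m x y) / ((n : ℝ) - 1)

/-- The Weyl-type curvature `T^i_k := R^i_k - (R δ^i_k - ½ R_{·k} y^i)`. -/
def Tcurv {n : ℕ} (G : Fin n → Vec n → Vec n → ℝ) (i k : Fin n) : Vec n → Vec n → ℝ :=
  fun x y => Riem G i k x y -
    (Ricci G x y * (if i = k then 1 else 0) - (1/2) * pdy (Ricci G) k x y * y i)

/-- The χ-curvature `χ_i := -(1/3) T^m_{i·m}`. -/
def chiC {n : ℕ} (G : Fin n → Vec n → Vec n → ℝ) (i : Fin n) : Vec n → Vec n → ℝ :=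
  fun x y => -(1/3) * ∑ m, pdy (Tcurv G m i) m x y

/-- The Weyl curvature `W^i_k := T^i_k + (3χ_k/(n+1)) y^i`. -/
def Weyl {n : ℕ} (G : Fin n → Vec n → Vec n → ℝ) (i k : Fin n) : Vec n → Vec n → ℝ :=
  fun x y => Tcurv G i k x y + (3 * chiC G k x y / ((n : ℝ) + 1)) * y i

/-- A volume form `dV = σ(x) dx` on `U`: `σ` smooth and positive. -/
def IsVolumeForm {n : ℕ} (U : Set (Vec n)) (σ : Vec n → ℝ) : Prop :=
  ContDiffOn ℝ (⊤ : ℕ∞) σ U ∧ ∀ x ∈ U, 0 < σ x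

/-- The S-curvature of `(G, dV)`: `S := ∂G^m/∂y^m - y^m ∂(ln σ)/∂x^m`. -/
def Scurv {n : ℕ} (G : Fin n → Vec n → Vec n → ℝ) (σ : Vec n → ℝ) : Vec n → Vec n → ℝ :=
  fun x y => ∑ m, Nc G m m x y
    - ∑ m, y m * fderiv ℝ (fun x' => Real.log (σ x')) x (Pi.single m 1)

/-- The projective spray `Ĝ^i := G^i - (S/(n+1)) y^i` of `(G, dV)`. -/
def Ghat {n : ℕ} (G : Fin n → Vec n → Vec n → ℝ) (σ : Vec n → ℝ) :
    Fin n → Vec n → Vec n → ℝ :=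
  fun i x y => G i x y - (Scurv G σ x y / ((n : ℝ) + 1)) * y i

/-- The Berwald–Weyl curvature `W^o_k := R̂_{∥k} - ½ R̂_{·k∥m} y^m` of `(G, dV)`,
where all hatted quantities and `∥` are taken with respect to the projective spray `Ĝ`. -/
def BWeyl {n : ℕ} (G : Fin n → Vec n → Vec n → ℝ) (σ : Vec n → ℝ) (k : Fin n) :
    Vec n → Vec n → ℝ :=
  fun x y => hD (Ghat G σ) (Ricci (Ghat G σ)) k x y
    - (1/2) * ∑ m, covD1 (Ghat G σ) (fun j => pdy (Ricci (Ghat G σ)) j) k m x y * y m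


/-- Commuting derivations modelling `∂/∂x^i`, `∂/∂y^i`, with fibre coordinates `y^i`. -/
structure VerticalCalculus (n : ℕ) (A : Type*) [CommRing A] [Algebra ℝ A] where
  X : Fin n → Derivation ℝ A A
  V : Fin n → Derivation ℝ A A
  y : Fin n → A
  X_X : ∀ i j f, X i (X j f) = X j (X i f)
  X_V : ∀ i j f, X i (V j f) = V j (X i f)
  V_V : ∀ i j f, V i (V j f) = V j (V i f)
  X_y : ∀ i j, X i (y j) = 0
  V_y : ∀ i j, V i (y j) = if i = j then 1 else 0

lemma derivation_two {A : Type*} [CommRing A] [Algebra ℝ A] (d : Derivation ℝ A A) : d 2 = 0 := by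
  exact_mod_cast d.map_natCast 2

namespace VerticalCalculus

variable {n : ℕ} {A : Type*} [CommRing A] [Algebra ℝ A] (J : VerticalCalculus n A)

/-- The Euler (Liouville) vector field `y^l ∂/∂y^l`. -/
def euler (f : A) : A := ∑ l, J.y l * J.V l f

/-- The spray vector field `y^m ∂/∂x^m - 2 G^l ∂/∂y^l`. -/
def sprayField (g : Fin n → A) : Derivation ℝ A A :=
  ∑ m, J.y m • J.X m - (2 : A) • ∑ l, g l • J.V l

lemma sprayField_apply (g : Fin n → A) (f : A) :
    J.sprayField g f = ∑ m, J.y m * J.X m f - 2 * ∑ l, g l * J.V l f := by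
  have h : ∀ (s : Finset (Fin n)) (a : Fin n → A) (Y : Fin n → Derivation ℝ A A),
      (∑ m ∈ s, a m • Y m) f = ∑ m ∈ s, a m * Y m f := by
    intro s a Y
    induction s using Finset.cons_induction with
    | empty => simp
    | cons i s hi ih =>
      rw [Finset.sum_cons, Finset.sum_cons, Derivation.add_apply, ih, Derivation.smul_apply,
        smul_eq_mul]
  simp [sprayField, h]

/-- `∂f/∂x^k - D(∂f/∂y^k)` for the spray vector field `D`. -/
def eulerLagrange (g : Fin n → A) (k : Fin n) (f : A) : A :=
  J.X k f - J.sprayField g (J.V k f)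

/-- The Riemann curvature `R^i_k`. -/
def riemann (g : Fin n → A) (i k : Fin n) : A :=
  2 * J.X k (g i) - J.sprayField g (J.V k (g i)) - ∑ s, J.V s (g i) * J.V k (g s)

/-- Twice `f_{|k} - ½ f_{·k|m} y^m`. -/
def berwald (g : Fin n → A) (k : Fin n) (f : A) : A :=
  2 * J.X k f - J.sprayField g (J.V k f) - ∑ l, J.V k (g l) * J.V l f

lemma V_sprayField (g : Fin n → A) (k : Fin n) (f : A) :
    J.V k (J.sprayField g f) =
      J.sprayField g (J.V k f) + J.X k f - 2 * ∑ l, J.V k (g l) * J.V l f := by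
  simp only [sprayField_apply, map_sub, map_sum, Derivation.leibniz, smul_eq_mul, derivation_two,
    J.V_y, Finset.sum_add_distrib, mul_ite, mul_one, mul_zero, Finset.sum_ite_eq, Finset.mem_univ,
    if_true]
  simp only [← J.X_V, J.V_V k, mul_comm (J.V _ f)]
  ring

lemma X_sprayField (g : Fin n → A) (k : Fin n) (f : A) :
    J.X k (J.sprayField g f) =
      J.sprayField g (J.X k f) - 2 * ∑ l, J.X k (g l) * J.V l f := by
  simp only [sprayField_apply, map_sub, map_sum, Derivation.leibniz, smul_eq_mul, derivation_two,
    J.X_y, Finset.sum_add_distrib, mul_zero, add_zero]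
  simp only [J.X_V, J.X_X k, mul_comm (J.V _ f)]
  ring

lemma euler_add (f h : A) : J.euler (f + h) = J.euler f + J.euler h := by
  simp [euler, mul_add, Finset.sum_add_distrib]

lemma euler_mul (f h : A) : J.euler (f * h) = f * J.euler h + h * J.euler f := by
  simp only [euler, Derivation.leibniz, smul_eq_mul, mul_add, Finset.sum_add_distrib,
    Finset.mul_sum]
  congr 1 <;> exact Finset.sum_congr rfl fun _ _ => by ring

lemma euler_sum {ι : Type*} (s : Finset ι) (f : ι → A) :
    J.euler (∑ i ∈ s, f i) = ∑ i ∈ s, J.euler (f i) := by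
  simp only [euler, map_sum, Finset.mul_sum]
  exact Finset.sum_comm

lemma euler_smul (c : ℝ) (f : A) : J.euler (c • f) = c • J.euler f := by
  simp [euler, Finset.smul_sum]

lemma euler_sub (f h : A) : J.euler (f - h) = J.euler f - J.euler h := by
  simp [euler, mul_sub, Finset.sum_sub_distrib]

lemma euler_y (m : Fin n) : J.euler (J.y m) = J.y m := by
  simp [euler, J.V_y]

lemma euler_X (k : Fin n) (f : A) : J.euler (J.X k f) = J.X k (J.euler f) := by
  simp [euler, map_sum, J.X_y, J.X_V]

lemma euler_V (k : Fin n) (f : A) : J.euler (J.V k f) = J.V k (J.euler f) - J.V k f := by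
  simp [euler, map_sum, J.V_y, J.V_V k, Finset.sum_add_distrib]

lemma euler_two : J.euler 2 = 0 := by
  simp [euler, derivation_two]

lemma euler_V_of_euler_eq_two_mul {f : A} (hf : J.euler f = 2 * f) (k : Fin n) :
    J.euler (J.V k f) = J.V k f := by
  simp only [euler_V, hf, Derivation.leibniz, smul_eq_mul, derivation_two]
  ring

lemma euler_sprayField {g : Fin n → A} (hg : ∀ i, J.euler (g i) = 2 * g i) (f : A) :
    J.euler (J.sprayField g f) = J.sprayField g (J.euler f) + J.sprayField g f := by
  simp only [sprayField_apply, euler_sub, euler_sum, euler_mul, euler_two, euler_y, euler_X,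
    euler_V, hg, Finset.mul_sum, ← Finset.sum_add_distrib, ← Finset.sum_sub_distrib]
  exact Finset.sum_congr rfl fun _ _ => by ring

section Trace

/-- The trace `∂G^m/∂y^m`. -/
def divergence (g : Fin n → A) : A := ∑ m, J.V m (g m)

lemma trace_riemann (g : Fin n → A) :
    ∑ m, J.riemann g m m = 2 * ∑ m, J.X m (g m) - J.sprayField g (J.divergence g)
      - ∑ m, ∑ s, J.V s (g m) * J.V m (g s) := by
  simp only [riemann, divergence, map_sum, Finset.sum_sub_distrib, Finset.mul_sum]

variable {g : Fin n → A} (hg : ∀ i, J.euler (g i) = 2 * g i)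
include hg

lemma euler_V_spray (k i : Fin n) : J.euler (J.V k (g i)) = J.V k (g i) :=
  J.euler_V_of_euler_eq_two_mul (hg i) k

lemma euler_divergence : J.euler (J.divergence g) = J.divergence g := by
  simp [divergence, euler_sum, J.euler_V_spray hg]

lemma euler_trace_riemann : J.euler (∑ m, J.riemann g m m) = 2 * ∑ m, J.riemann g m m := by
  simp only [trace_riemann, euler_sub, euler_two, euler_sum, euler_X, hg,
    J.euler_sprayField hg, J.euler_divergence hg, euler_mul, J.euler_V_spray hg,
    Derivation.leibniz, smul_eq_mul, derivation_two, mul_zero, add_zero, Finset.mul_sum, mul_sub]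
  congr 1
  · ring
  · exact Finset.sum_congr rfl fun _ _ => Finset.sum_congr rfl fun _ _ => by ring

end Trace

/-- `2 R^m_{k·m} + R^m_{m·k} = 3 (∂_k - D ∂_{·k}) N^m_m`. -/
lemma divergence_riemann (g : Fin n → A) (k : Fin n) :
    2 * ∑ m, J.V m (J.riemann g m k) + J.V k (∑ m, J.riemann g m m) =
      3 * J.eulerLagrange g k (J.divergence g) := by
  have hdiv : ∀ i, J.V i (J.divergence g) = ∑ m, J.V m (J.V i (g m)) := fun i => by
    simp only [divergence, map_sum, J.V_V i]
  have e1 : ∑ m, J.V m (J.riemann g m k) =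
      2 * J.X k (J.divergence g) - J.sprayField g (J.V k (J.divergence g))
        - ∑ m, J.X m (J.V k (g m)) + ∑ m, ∑ l, J.V m (g l) * J.V l (J.V k (g m))
        - ∑ l, J.V k (g l) * J.V l (J.divergence g) := by
    have c : ∑ m, ∑ s, J.V s (g m) * J.V m (J.V k (g s)) =
        ∑ m, ∑ l, J.V m (g l) * J.V l (J.V k (g m)) := Finset.sum_comm
    have d : ∑ m, ∑ s, J.V k (g s) * J.V m (J.V s (g m)) =
        ∑ l, J.V k (g l) * J.V l (J.divergence g) := by
      simp only [hdiv, Finset.mul_sum]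
      exact Finset.sum_comm
    have e : ∑ m, J.sprayField g (J.V m (J.V k (g m))) =
        J.sprayField g (J.V k (J.divergence g)) := by rw [hdiv, map_sum]
    simp only [riemann, map_sub, map_sum, Derivation.leibniz, smul_eq_mul, derivation_two,
      mul_zero, add_zero, V_sprayField, Finset.sum_sub_distrib, Finset.sum_add_distrib, c, d, e,
      ← Finset.mul_sum]
    simp only [divergence, map_sum, ← J.X_V]
    ring
  have e2 : J.V k (∑ m, J.riemann g m m) =
      2 * ∑ m, J.X m (J.V k (g m)) - (J.sprayField g (J.V k (J.divergence g))
        + J.X k (J.divergence g) - 2 * ∑ l, J.V k (g l) * J.V l (J.divergence g))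
        - 2 * ∑ m, ∑ l, J.V m (g l) * J.V l (J.V k (g m)) := by
    have c : ∑ m, ∑ s, J.V s (g m) * J.V m (J.V k (g s)) =
        ∑ m, ∑ l, J.V m (g l) * J.V l (J.V k (g m)) := Finset.sum_comm
    simp only [trace_riemann, map_sub, map_sum, Derivation.leibniz, smul_eq_mul, derivation_two,
      mul_zero, add_zero, V_sprayField, Finset.sum_add_distrib, J.V_V k, J.X_V, c]
    ring
  rw [e1, e2, eulerLagrange]
  ring

section Projective

variable {g : Fin n → A} (hg : ∀ i, J.euler (g i) = 2 * g i) {P : A} (hP : J.euler P = P)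

/-- The projective change `G^i + P y^i` of a spray. -/
def projective (g : Fin n → A) (P : A) (i : Fin n) : A := g i + P * J.y i

lemma sprayField_projective (f : A) :
    J.sprayField (J.projective g P) f = J.sprayField g f - 2 * P * J.euler f := by
  simp only [sprayField_apply, projective, euler, add_mul, Finset.sum_add_distrib,
    mul_assoc, ← Finset.mul_sum]
  ring

lemma V_projective (k i : Fin n) : J.V k (J.projective g P i) =
    J.V k (g i) + J.V k P * J.y i + if k = i then P else 0 := by
  simp only [projective, map_add, Derivation.leibniz, smul_eq_mul, J.V_y, mul_ite, mul_one,
    mul_zero]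
  ring

lemma berwald_projective (k : Fin n) {f : A} (hf : J.euler f = 2 * f) :
    J.berwald (J.projective g P) k f = J.berwald g k f + P * J.V k f - 2 * J.V k P * f := by
  have hVf : J.euler (J.V k f) = J.V k f := J.euler_V_of_euler_eq_two_mul hf k
  have hs : ∑ l, J.V k (J.projective g P l) * J.V l f =
      ∑ l, J.V k (g l) * J.V l f + 2 * J.V k P * f + P * J.V k f := by
    simp only [V_projective, add_mul, Finset.sum_add_distrib, ite_mul, zero_mul,
      Finset.sum_ite_eq, Finset.mem_univ, if_true, mul_assoc, ← Finset.mul_sum]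
    rw [← euler, hf]
    ring
  rw [berwald, berwald, hs, sprayField_projective, hVf]
  ring

include hP in
lemma divergence_projective :
    J.divergence (J.projective g P) = J.divergence g + (n + 1) * P := by
  simp only [divergence, V_projective, Finset.sum_add_distrib, if_true, Finset.sum_const,
    Finset.card_univ, Fintype.card_fin, nsmul_eq_mul]
  have : ∑ m, J.V m P * J.y m = P := by
    conv_rhs => rw [← hP, euler]
    exact Finset.sum_congr rfl fun _ _ => mul_comm _ _
  rw [this]
  ring

include hg hP in
lemma trace_riemann_projective :
    ∑ m, J.riemann (J.projective g P) m m =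
      ∑ m, J.riemann g m m + (n - 1) * (P ^ 2 - J.sprayField g P) := by
  have hPy : ∑ m, J.V m P * J.y m = P := by
    conv_rhs => rw [← hP, euler]
    exact Finset.sum_congr rfl fun _ _ => mul_comm _ _
  have hX : ∑ m, J.X m (J.projective g P m) = ∑ m, J.X m (g m) + ∑ m, J.y m * J.X m P := by
    simp [projective, J.X_y, Finset.sum_add_distrib]
  have hNP : ∑ m, ∑ s, J.V s (g m) * (J.V m P * J.y s) = 2 * ∑ m, g m * J.V m P := by
    rw [Finset.mul_sum]
    refine Finset.sum_congr rfl fun m _ => ?_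
    rw [← mul_assoc, ← hg m, euler, Finset.sum_mul]
    exact Finset.sum_congr rfl fun _ _ => by ring
  have hN : ∑ m, ∑ s, J.V s (J.projective g P m) * J.V m (J.projective g P s) =
      ∑ m, ∑ s, J.V s (g m) * J.V m (g s) + 4 * ∑ m, g m * J.V m P
        + 2 * P * J.divergence g + (n + 3) * P ^ 2 := by
    have hPN : ∑ m, ∑ s, (J.V s P * J.y m) * J.V m (g s) = 2 * ∑ m, g m * J.V m P := by
      rw [← hNP, Finset.sum_comm]
      exact Finset.sum_congr rfl fun _ _ => Finset.sum_congr rfl fun _ _ => by ring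
    have hPP : ∑ m, ∑ s, (J.V s P * J.y m) * (J.V m P * J.y s) = P ^ 2 := by
      rw [sq]
      conv_rhs => rw [← hPy, Finset.sum_mul_sum]
      exact Finset.sum_congr rfl fun _ _ => Finset.sum_congr rfl fun _ _ => by ring
    simp only [V_projective, add_mul, mul_add, Finset.sum_add_distrib, hNP, hPN, hPP, ite_mul,
      mul_ite, zero_mul, mul_zero, Finset.sum_ite_eq, Finset.sum_ite_eq', Finset.mem_univ,
      if_true, Finset.sum_const, Finset.card_univ, Fintype.card_fin, nsmul_eq_mul,
      ← Finset.sum_mul, ← Finset.mul_sum, hPy]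
    rw [divergence]
    ring
  have hn1 : J.sprayField g ((n : A) + 1) = 0 := by
    exact_mod_cast (J.sprayField g).map_natCast (n + 1)
  have hD : J.sprayField (J.projective g P) (J.divergence (J.projective g P)) =
      J.sprayField g (J.divergence g) + (n + 1) * J.sprayField g P
        - 2 * P * (J.divergence g + (n + 1) * P) := by
    have he : J.euler ((n + 1) * P) = (n + 1) * P := by
      have : ((n : A) + 1) * P = ((n : ℝ) + 1) • P := by
        simp [Algebra.smul_def]
      rw [this, euler_smul, hP]
    rw [J.divergence_projective hP, sprayField_projective, map_add, Derivation.leibniz, hn1,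
      euler_add, he, J.euler_divergence hg]
    simp only [smul_eq_mul]
    ring
  rw [trace_riemann, trace_riemann, hX, hN, hD, J.sprayField_apply g P]
  ring

lemma berwald_sprayField (k : Fin n) (f : A) :
    J.berwald g k (J.sprayField g f) =
      J.sprayField g (J.eulerLagrange g k f) - ∑ l, J.V k (g l) * J.eulerLagrange g l f
        - 2 * ∑ m, J.riemann g m k * J.V m f := by
  have hc : ∑ m, ∑ s, J.V s (g m) * J.V k (g s) * J.V m f =
      ∑ l, J.V k (g l) * ∑ s, J.V l (g s) * J.V s f := by
    simp only [Finset.mul_sum]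
    rw [Finset.sum_comm]
    exact Finset.sum_congr rfl fun _ _ => Finset.sum_congr rfl fun _ _ => by ring
  simp only [berwald, eulerLagrange, riemann, X_sprayField, V_sprayField, map_sub, map_add,
    map_sum, Derivation.leibniz, smul_eq_mul, derivation_two, mul_zero, add_zero,
    mul_sub, mul_add, sub_mul, Finset.sum_sub_distrib, Finset.sum_add_distrib, Finset.sum_mul,
    hc]
  simp only [mul_left_comm _ (2 : A), mul_assoc (2 : A), ← Finset.mul_sum,
    mul_comm (J.V _ f)]
  ring

lemma berwald_add (k : Fin n) (f h : A) :
    J.berwald g k (f + h) = J.berwald g k f + J.berwald g k h := by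
  simp only [berwald, map_add, mul_add, Finset.sum_add_distrib]
  ring

lemma berwald_sub (k : Fin n) (f h : A) :
    J.berwald g k (f - h) = J.berwald g k f - J.berwald g k h := by
  simp only [berwald, map_sub, mul_sub, Finset.sum_sub_distrib]
  ring

include hP in
/-- The contraction of the Weyl curvature with the vertical derivative of `P`. -/
lemma sum_weyl_mul (k : Fin n) (R ψ φ : A) :
    ∑ m, (J.riemann g m k - (R * (if m = k then 1 else 0) - φ * J.y m) + ψ * J.y m) * J.V m P =
      ∑ m, J.riemann g m k * J.V m P - R * J.V k P + φ * P + ψ * P := by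
  have hyP : ∑ m, J.y m * J.V m P = P := hP
  simp only [add_mul, sub_mul, Finset.sum_add_distrib, Finset.sum_sub_distrib, mul_ite, ite_mul,
    mul_one, mul_zero, zero_mul, Finset.sum_ite_eq', Finset.mem_univ, if_true, mul_assoc,
    ← Finset.mul_sum, hyP]
  ring

include hg hP in
/-- The projective change of the Berwald–Weyl form of a function of the form
`R + P² - P_{|m} y^m`. -/
lemma berwald_projective_ricci (k : Fin n) {R : A} (hR : J.euler R = 2 * R) :
    J.berwald (J.projective g P) k (R + (P ^ 2 - J.sprayField g P)) =
      J.berwald g k R + P * J.V k R - 2 * J.V k P * R + 2 * ∑ m, J.riemann g m k * J.V m P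
        + 3 * P * J.eulerLagrange g k P - J.sprayField g (J.eulerLagrange g k P)
        + ∑ l, J.V k (g l) * J.eulerLagrange g l P := by
  have hPP : J.berwald g k (P ^ 2) = 2 * (P * (2 * J.X k P)
      - P * J.sprayField g (J.V k P) - J.V k P * J.sprayField g P
      - P * ∑ l, J.V k (g l) * J.V l P) := by
    have : ∑ l, J.V k (g l) * (P * J.V l P) = P * ∑ l, J.V k (g l) * J.V l P := by
      rw [Finset.mul_sum]
      exact Finset.sum_congr rfl fun _ _ => by ring
    simp only [berwald, sq, Derivation.leibniz, smul_eq_mul, map_add, mul_add,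
      Finset.sum_add_distrib, this]
    ring
  have hf : J.euler (R + (P ^ 2 - J.sprayField g P)) = 2 * (R + (P ^ 2 - J.sprayField g P)) := by
    rw [euler_add, euler_sub, sq, euler_mul, J.euler_sprayField hg, hR, hP]
    ring
  rw [J.berwald_projective k hf, berwald_add, berwald_sub, hPP, berwald_sprayField]
  simp only [map_add, map_sub, V_sprayField, sq, Derivation.leibniz, smul_eq_mul]
  rw [eulerLagrange]
  ring

end Projective

end VerticalCalculus

section SmoothFunctions

variable {E : Type*} [NormedAddCommGroup E] [NormedSpace ℝ E]

/-- Extension by zero of a function on a subset. -/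
def extendZero {Ω : Set E} (f : Ω → ℝ) : E → ℝ := Function.extend Subtype.val f 0

omit [NormedAddCommGroup E] [NormedSpace ℝ E] in
lemma extendZero_coe {Ω : Set E} (f : Ω → ℝ) (p : Ω) : extendZero f p = f p :=
  Subtype.val_injective.extend_apply f 0 p

/-- The algebra of smooth real functions on a subset of a normed space. -/
def smoothFunctions (Ω : Set E) : Subalgebra ℝ (Ω → ℝ) where
  carrier := {f | ContDiffOn ℝ (⊤ : ℕ∞) (extendZero f) Ω}
  mul_mem' {f h} hf hh := (ContDiffOn.mul hf hh).congr fun p hp => by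
    simp [extendZero_coe _ (⟨p, hp⟩ : Ω)]
  add_mem' {f h} hf hh := (ContDiffOn.add hf hh).congr fun p hp => by
    simp [extendZero_coe _ (⟨p, hp⟩ : Ω)]
  algebraMap_mem' c := (contDiffOn_const (c := c)).congr fun p hp => by
    simp [extendZero_coe _ (⟨p, hp⟩ : Ω)]

lemma restrict_mem_smoothFunctions {Ω : Set E} {F : E → ℝ} (hF : ContDiffOn ℝ (⊤ : ℕ∞) F Ω) :
    (fun p : Ω => F p) ∈ smoothFunctions Ω :=
  ContDiffOn.congr hF fun p hp => extendZero_coe _ (⟨p, hp⟩ : Ω)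

/-- The restriction of a smooth function. -/
def smoothRestrict {Ω : Set E} (F : E → ℝ) (hF : ContDiffOn ℝ (⊤ : ℕ∞) F Ω) : smoothFunctions Ω :=
  ⟨fun p => F p, restrict_mem_smoothFunctions hF⟩

variable {Ω : Set E} (hΩ : IsOpen Ω)
include hΩ

lemma fderiv_extendZero {F : E → ℝ} {f : Ω → ℝ} (h : ∀ p : Ω, F p = f p) (p : Ω) :
    fderiv ℝ (extendZero f) p = fderiv ℝ F p :=
  Filter.EventuallyEq.fderiv_eq <| by
    filter_upwards [hΩ.mem_nhds p.2] with q hq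
    rw [extendZero_coe f ⟨q, hq⟩, ← h]

lemma smoothFunctions_contDiffAt (f : smoothFunctions Ω) (p : Ω) :
    ContDiffAt ℝ (⊤ : ℕ∞) (extendZero f.1) p :=
  ContDiffOn.contDiffAt f.2 (hΩ.mem_nhds p.2)

lemma smoothFunctions_differentiableAt (f : smoothFunctions Ω) (p : Ω) :
    DifferentiableAt ℝ (extendZero f.1) p :=
  (smoothFunctions_contDiffAt hΩ f p).differentiableAt (by simp)

/-- The directional derivative as a derivation of the algebra of smooth functions. -/
def directionalDerivation (v : E) : Derivation ℝ (smoothFunctions Ω) (smoothFunctions Ω) :=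
  Derivation.mk'
    { toFun f := smoothRestrict (fun p => fderiv ℝ (extendZero f.1) p v)
        ((ContDiffOn.fderiv_of_isOpen f.2 hΩ (by simp)).clm_apply contDiffOn_const)
      map_add' f h := by
        ext p
        have := fderiv_extendZero hΩ (F := extendZero f.1 + extendZero h.1) (f := (f + h).1)
          (fun q => by simp [extendZero_coe]) p
        simp only [smoothRestrict, this]
        rw [fderiv_add (smoothFunctions_differentiableAt hΩ f p)
          (smoothFunctions_differentiableAt hΩ h p)]
        rfl
      map_smul' c f := by
        ext p
        have := fderiv_extendZero hΩ (F := c • extendZero f.1) (f := (c • f).1)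
          (fun q => by simp [extendZero_coe]) p
        simp only [smoothRestrict, this]
        rw [fderiv_const_smul (smoothFunctions_differentiableAt hΩ f p)]
        rfl }
    (fun f h => by
      ext p
      have := fderiv_extendZero hΩ (F := extendZero f.1 * extendZero h.1) (f := (f * h).1)
        (fun q => by simp [extendZero_coe]) p
      simp only [LinearMap.coe_mk, AddHom.coe_mk, smoothRestrict, this]
      rw [fderiv_mul (smoothFunctions_differentiableAt hΩ f p)
        (smoothFunctions_differentiableAt hΩ h p)]
      simp [extendZero_coe])

lemma directionalDerivation_apply {F : E → ℝ} {f : smoothFunctions Ω} (h : ∀ p : Ω, F p = f.1 p)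
    (v : E) (p : Ω) : (directionalDerivation hΩ v f).1 p = fderiv ℝ F p v := by
  rw [← fderiv_extendZero hΩ h]
  rfl

lemma directionalDerivation_comm (v w : E) (f : smoothFunctions Ω) :
    directionalDerivation hΩ v (directionalDerivation hΩ w f) =
      directionalDerivation hΩ w (directionalDerivation hΩ v f) := by
  have key : ∀ (v w : E) (p : Ω),
      (directionalDerivation hΩ v (directionalDerivation hΩ w f)).1 p =
        fderiv ℝ (fderiv ℝ (extendZero f.1)) p v w := fun v w p => by
    rw [directionalDerivation_apply hΩ (F := fun q => fderiv ℝ (extendZero f.1) q w)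
      (fun q => rfl)]
    have hd : DifferentiableAt ℝ (fderiv ℝ (extendZero f.1)) p :=
      ((smoothFunctions_contDiffAt hΩ f p).fderiv_right (m := 1) (by norm_cast)).differentiableAt
        (by simp)
    rw [fderiv_clm_apply hd (differentiableAt_const w)]
    simp
  ext p
  rw [key, key]
  exact ((smoothFunctions_contDiffAt hΩ f p).isSymmSndFDerivAt
    (by rw [minSmoothness_of_isRCLikeNormedField]; norm_cast)) v w

end SmoothFunctions

section Slit

variable {n : ℕ} {U : Set (Vec n)}

lemma isOpen_prod_slit (hU : IsOpen U) : IsOpen (U ×ˢ slit n) :=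
  hU.prod isOpen_ne

/-- The coordinate fields on `U × (ℝⁿ \ {0})`. -/
def slitCalculus (hU : IsOpen U) : VerticalCalculus n (smoothFunctions (U ×ˢ slit n)) where
  X i := directionalDerivation (isOpen_prod_slit hU) (Pi.single i 1, 0)
  V i := directionalDerivation (isOpen_prod_slit hU) (0, Pi.single i 1)
  y i := smoothRestrict (fun p => p.2 i) (by fun_prop)
  X_X _ _ _ := directionalDerivation_comm _ _ _ _
  X_V _ _ _ := directionalDerivation_comm _ _ _ _
  V_V _ _ _ := directionalDerivation_comm _ _ _ _
  X_y i j := by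
    ext p
    rw [directionalDerivation_apply _ (F := (ContinuousLinearMap.proj j).comp
      (ContinuousLinearMap.snd ℝ (Vec n) (Vec n))) (fun _ => rfl), ContinuousLinearMap.fderiv]
    simp
  V_y i j := by
    ext p
    rw [directionalDerivation_apply _ (F := (ContinuousLinearMap.proj j).comp
      (ContinuousLinearMap.snd ℝ (Vec n) (Vec n))) (fun _ => rfl), ContinuousLinearMap.fderiv]
    by_cases h : i = j
    · subst h
      simp
    · simp [h, Ne.symm h]

/-- `f` agrees with the smooth function `a` on `U × (ℝⁿ \ {0})`. -/
def Represents (a : smoothFunctions (U ×ˢ slit n)) (f : Vec n → Vec n → ℝ) : Prop :=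
  ∀ p : (U ×ˢ slit n : Set (Vec n × Vec n)), f p.1.1 p.1.2 = a.1 p

namespace Represents

variable {a b : smoothFunctions (U ×ˢ slit n)} {f h : Vec n → Vec n → ℝ}

lemma add (ha : Represents a f) (hb : Represents b h) :
    Represents (a + b) (fun x y => f x y + h x y) := fun p => by
  simp [ha p, hb p]

lemma sub (ha : Represents a f) (hb : Represents b h) :
    Represents (a - b) (fun x y => f x y - h x y) := fun p => by
  simp [ha p, hb p]

lemma mul (ha : Represents a f) (hb : Represents b h) :
    Represents (a * b) (fun x y => f x y * h x y) := fun p => by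
  simp [ha p, hb p]

lemma smul (c : ℝ) (ha : Represents a f) : Represents (c • a) (fun x y => c * f x y) := fun p => by
  simp [ha p]

lemma sum {ι : Type*} [Fintype ι] {a : ι → smoothFunctions (U ×ˢ slit n)}
    {f : ι → Vec n → Vec n → ℝ} (ha : ∀ i, Represents (a i) (f i)) :
    Represents (∑ i, a i) (fun x y => ∑ i, f i x y) := fun p => by
  simp [fun i => ha i p]

lemma coord (hU : IsOpen U) (m : Fin n) :
    Represents ((slitCalculus hU).y m) (fun _ y => y m) := fun _ => rfl

lemma pdx (hU : IsOpen U) (ha : Represents a f) (k : Fin n) :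
    Represents ((slitCalculus hU).X k a) (pdx f k) := fun p => by
  have hd := (smoothFunctions_differentiableAt (isOpen_prod_slit hU) a p).hasFDerivAt
  have hc : HasFDerivAt (fun x' : Vec n => (x', p.1.2))
      (ContinuousLinearMap.inl ℝ (Vec n) (Vec n)) p.1.1 := hasFDerivAt_prodMk_left _ _
  have hcomp := HasFDerivAt.comp (g := extendZero a.1) p.1.1 hd hc
  have heq : (fun x' => f x' p.1.2) =ᶠ[nhds p.1.1]
      extendZero a.1 ∘ fun x' : Vec n => (x', p.1.2) := by
    filter_upwards [hU.mem_nhds p.2.1] with x' hx'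
    exact (ha ⟨(x', p.1.2), hx', p.2.2⟩).trans (extendZero_coe a.1 _).symm
  simp only [_root_.pdx]
  rw [heq.fderiv_eq, hcomp.fderiv]
  rfl

lemma pdy (hU : IsOpen U) (ha : Represents a f) (k : Fin n) :
    Represents ((slitCalculus hU).V k a) (pdy f k) := fun p => by
  have hd := (smoothFunctions_differentiableAt (isOpen_prod_slit hU) a p).hasFDerivAt
  have hc : HasFDerivAt (fun y' : Vec n => (p.1.1, y'))
      (ContinuousLinearMap.inr ℝ (Vec n) (Vec n)) p.1.2 := hasFDerivAt_prodMk_right _ _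
  have hcomp := HasFDerivAt.comp (g := extendZero a.1) p.1.2 hd hc
  have heq : (fun y' => f p.1.1 y') =ᶠ[nhds p.1.2]
      extendZero a.1 ∘ fun y' : Vec n => (p.1.1, y') := by
    filter_upwards [isOpen_ne.mem_nhds p.2.2] with y' hy'
    exact (ha ⟨(p.1.1, y'), p.2.1, hy'⟩).trans (extendZero_coe a.1 _).symm
  simp only [_root_.pdy]
  rw [heq.fderiv_eq, hcomp.fderiv]
  rfl

lemma congr (ha : Represents a f) (hab : a = b) : Represents b f := hab ▸ ha

end Represents

variable (hU : IsOpen U)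

/-- Euler's theorem for positively homogeneous functions of degree two. -/
lemma euler_of_homogeneous {a : smoothFunctions (U ×ˢ slit n)} {f : Vec n → Vec n → ℝ}
    (ha : Represents a f)
    (hf : ∀ x ∈ U, ∀ y ∈ slit n, ∀ c : ℝ, 0 < c → f x (c • y) = c ^ 2 * f x y) :
    (slitCalculus hU).euler a = 2 * a := by
  ext p
  have hd := (smoothFunctions_differentiableAt (isOpen_prod_slit hU) a p).hasFDerivAt
  have hc : HasDerivAt (fun c : ℝ => (p.1.1, c • p.1.2)) (0, p.1.2) 1 := by
    simpa using (hasDerivAt_const (1 : ℝ) p.1.1).prodMk ((hasDerivAt_id (1 : ℝ)).smul_const p.1.2)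
  have hp : (p.1.1, (1 : ℝ) • p.1.2) = p.1 := by simp
  have hcomp : HasDerivAt (fun c : ℝ => extendZero a.1 (p.1.1, c • p.1.2))
      (fderiv ℝ (extendZero a.1) p.1 (0, p.1.2)) 1 :=
    HasFDerivAt.comp_hasDerivAt (l := extendZero a.1) 1 (hp.symm ▸ hd) hc
  have hsq : HasDerivAt (fun c : ℝ => c ^ 2 * f p.1.1 p.1.2) (2 * f p.1.1 p.1.2) 1 := by
    simpa using (hasDerivAt_pow 2 (1 : ℝ)).mul_const (f p.1.1 p.1.2)
  have heq : (fun c : ℝ => extendZero a.1 (p.1.1, c • p.1.2)) =ᶠ[nhds 1]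
      fun c : ℝ => c ^ 2 * f p.1.1 p.1.2 := by
    filter_upwards [lt_mem_nhds (zero_lt_one : (0 : ℝ) < 1)] with c hc
    rw [← hf _ p.2.1 _ p.2.2 c hc]
    have hm : (p.1.1, c • p.1.2) ∈ U ×ˢ slit n := ⟨p.2.1, smul_ne_zero hc.ne' p.2.2⟩
    exact (extendZero_coe a.1 ⟨_, hm⟩).trans (ha ⟨_, hm⟩).symm
  have huniq := hcomp.unique (hsq.congr_of_eventuallyEq heq)
  have hsum : ((0 : Vec n), p.1.2) = ∑ l, p.1.2 l • ((0 : Vec n), (Pi.single l 1 : Vec n)) := by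
    refine Prod.ext (by simp [Prod.fst_sum]) ?_
    ext j
    simp [Prod.snd_sum, Finset.sum_apply, Pi.single_apply]
  rw [hsum, map_sum, ha p] at huniq
  simp only [map_smul, smul_eq_mul] at huniq
  simp only [VerticalCalculus.euler, AddSubmonoidClass.coe_finsetSum, Finset.sum_apply]
  exact huniq

open VerticalCalculus

variable {g : Fin n → smoothFunctions (U ×ˢ slit n)} {G : Fin n → Vec n → Vec n → ℝ}
  (hG : ∀ i, Represents (g i) (G i))
include hG

lemma represents_Riem (i k : Fin n) :
    Represents ((slitCalculus hU).riemann g i k) (Riem G i k) := by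
  have h := ((((hG i).pdx hU k).smul 2).sub
    (Represents.sum fun j => (Represents.coord hU j).mul (((hG i).pdx hU j).pdy hU k))).add
    ((Represents.sum fun j => (hG j).mul (((hG i).pdy hU j).pdy hU k)).smul 2) |>.sub
    (Represents.sum fun s => ((hG i).pdy hU s).mul ((hG s).pdy hU k))
  refine h.congr ?_
  simp only [riemann, sprayField_apply, X_V, (slitCalculus hU).V_V k, ofNat_smul_eq_nsmul,
    nsmul_eq_mul, Nat.cast_ofNat]
  ring

lemma represents_Ricci :
    Represents (((n : ℝ) - 1)⁻¹ • ∑ m, (slitCalculus hU).riemann g m m) (Ricci G) := by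
  intro p
  rw [(Represents.sum fun m => represents_Riem hU hG m m).smul ((n : ℝ) - 1)⁻¹ p |>.symm]
  simp only [Ricci, div_eq_inv_mul]

lemma represents_hD {a : smoothFunctions (U ×ˢ slit n)} {f : Vec n → Vec n → ℝ}
    (ha : Represents a f) (k : Fin n) :
    Represents ((slitCalculus hU).X k a
      - ∑ l, (slitCalculus hU).V k (g l) * (slitCalculus hU).V l a) (hD G f k) :=
  (ha.pdx hU k).sub (Represents.sum fun l => ((hG l).pdy hU k).mul (ha.pdy hU l))

/-- The contraction `A_{k|m} y^m` in terms of the spray field. -/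
lemma represents_sum_covD1 (hg : ∀ i, (slitCalculus hU).euler (g i) = 2 * g i)
    {a : Fin n → smoothFunctions (U ×ˢ slit n)} {A : Fin n → Vec n → Vec n → ℝ}
    (ha : ∀ i, Represents (a i) (A i)) (k : Fin n) :
    Represents ((slitCalculus hU).sprayField g (a k) - ∑ l, (slitCalculus hU).V k (g l) * a l)
      (fun x y => ∑ m, covD1 G A k m x y * y m) := by
  set J := slitCalculus hU
  have h := Represents.sum fun m => ((represents_hD hU hG (ha k) m).sub
    (Represents.sum fun l => (ha l).mul (((hG l).pdy hU k).pdy hU m))).mul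
    (Represents.coord hU m)
  refine h.congr ?_
  have e1 : ∑ m, (∑ l, J.V m (g l) * J.V l (a k)) * J.y m = 2 * ∑ l, g l * J.V l (a k) := by
    simp only [Finset.sum_mul]
    rw [Finset.sum_comm, Finset.mul_sum]
    refine Finset.sum_congr rfl fun l _ => ?_
    rw [← mul_assoc, ← hg l, euler, Finset.sum_mul]
    exact Finset.sum_congr rfl fun _ _ => by ring
  have e2 : ∑ m, (∑ l, a l * J.V m (J.V k (g l))) * J.y m = ∑ l, J.V k (g l) * a l := by
    simp only [Finset.sum_mul]
    rw [Finset.sum_comm]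
    refine Finset.sum_congr rfl fun l _ => ?_
    conv_rhs => rw [← J.euler_V_spray hg, euler, Finset.sum_mul]
    exact Finset.sum_congr rfl fun _ _ => by ring
  simp only [sub_mul, Finset.sum_sub_distrib]
  rw [e1, e2, sprayField_apply]
  congr 3
  exact funext fun m => mul_comm (J.X m (a k)) (J.y m)

/-- `f_{|k} - ½ f_{·k|m} y^m` is half of `VerticalCalculus.berwald`. -/
lemma represents_berwald (hg : ∀ i, (slitCalculus hU).euler (g i) = 2 * g i)
    {a : smoothFunctions (U ×ˢ slit n)} {f : Vec n → Vec n → ℝ}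
    (ha : Represents a f) (k : Fin n) :
    Represents ((1 / 2 : ℝ) • (slitCalculus hU).berwald g k a)
      (fun x y => hD G f k x y - (1 / 2) * ∑ m, covD1 G (fun j => pdy f j) k m x y * y m) := by
  refine ((represents_hD hU hG ha k).sub ((represents_sum_covD1 hU hG hg
    (fun j => ha.pdy hU j) k).smul (1 / 2))).congr ?_
  simp only [berwald, two_mul]
  module

lemma represents_Tcurv (i k : Fin n) :
    Represents ((slitCalculus hU).riemann g i k -
      (((n : ℝ) - 1)⁻¹ • (∑ m, (slitCalculus hU).riemann g m m) * (if i = k then 1 else 0)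
        - (1 / 2 : ℝ) • (slitCalculus hU).V k
          (((n : ℝ) - 1)⁻¹ • ∑ m, (slitCalculus hU).riemann g m m) * (slitCalculus hU).y i))
      (Tcurv G i k) := by
  have hd : Represents (if i = k then 1 else 0 : smoothFunctions (U ×ˢ slit n))
      (fun _ _ => if i = k then 1 else 0) := fun p => by
    split_ifs <;> simp
  exact (represents_Riem hU hG i k).sub (((represents_Ricci hU hG).mul hd).sub
    ((((represents_Ricci hU hG).pdy hU k).smul (1 / 2)).mul (Represents.coord hU i)))

lemma represents_chiC (hn : 2 ≤ n) (hg : ∀ i, (slitCalculus hU).euler (g i) = 2 * g i)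
    (k : Fin n) :
    Represents (-(1 / 2 : ℝ) • (slitCalculus hU).eulerLagrange g k
      ((slitCalculus hU).divergence g)) (chiC G k) := by
  refine ((Represents.sum fun m => (represents_Tcurv hU hG m k).pdy hU m).smul
    (-(1 / 3))).congr ?_
  set J := slitCalculus hU
  have hn1 : (n : ℝ) - 1 ≠ 0 := by
    have : (2 : ℝ) ≤ n := by exact_mod_cast hn
    linarith
  set ρ : smoothFunctions (U ×ˢ slit n) := ((n : ℝ) - 1)⁻¹ • ∑ m, J.riemann g m m with hρ
  have hR : ∑ m, J.riemann g m m = ((n : ℝ) - 1) • ρ := by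
    rw [hρ, smul_inv_smul₀ hn1]
  have heρ : J.euler (J.V k ρ) = J.V k ρ := by
    refine J.euler_V_of_euler_eq_two_mul ?_ k
    rw [hρ, euler_smul, J.euler_trace_riemann hg, mul_smul_comm]
  have hδ : ∀ m, J.V m (if m = k then 1 else 0 : smoothFunctions (U ×ˢ slit n)) = 0 := fun m => by
    split_ifs <;> simp
  have hT : ∑ m, J.V m (J.riemann g m k - (ρ * (if m = k then 1 else 0)
      - (1 / 2 : ℝ) • J.V k ρ * J.y m)) =
      ∑ m, J.V m (J.riemann g m k) + (((n : ℝ) - 1) / 2) • J.V k ρ := by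
    have hy : ∑ m, J.y m * J.V m ((1 / 2 : ℝ) • J.V k ρ) = (1 / 2 : ℝ) • J.V k ρ := by
      rw [← euler, euler_smul, heρ]
    simp only [map_sub, Derivation.leibniz, hδ, smul_eq_mul, J.V_y, if_true,
      Finset.sum_sub_distrib, Finset.sum_add_distrib, hy, ite_mul, one_mul, zero_mul, mul_zero,
      mul_one, zero_add, Finset.sum_ite_eq', Finset.mem_univ, Finset.sum_const, Finset.card_univ,
      Fintype.card_fin, ← Nat.cast_smul_eq_nsmul ℝ]
    module
  have hdiv := J.divergence_riemann g k
  rw [hR, Derivation.map_smul] at hdiv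
  rw [hT]
  have h3 : (3 : ℝ) • J.eulerLagrange g k (J.divergence g) =
      (2 : ℝ) • ∑ m, J.V m (J.riemann g m k) + ((n : ℝ) - 1) • J.V k ρ := by
    simp only [ofNat_smul_eq_nsmul, nsmul_eq_mul, Nat.cast_ofNat]
    exact hdiv.symm
  have : J.eulerLagrange g k (J.divergence g) = (1 / 3 : ℝ) •
      ((2 : ℝ) • ∑ m, J.V m (J.riemann g m k) + ((n : ℝ) - 1) • J.V k ρ) := by
    rw [← h3]
    module
  rw [this]
  module

lemma represents_Weyl {χ : smoothFunctions (U ×ˢ slit n)} {k : Fin n}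
    (hχ : Represents χ (chiC G k)) (i : Fin n) :
    Represents ((slitCalculus hU).riemann g i k -
      (((n : ℝ) - 1)⁻¹ • (∑ m, (slitCalculus hU).riemann g m m) * (if i = k then 1 else 0)
        - (1 / 2 : ℝ) • (slitCalculus hU).V k
          (((n : ℝ) - 1)⁻¹ • ∑ m, (slitCalculus hU).riemann g m m) * (slitCalculus hU).y i)
      + (3 / ((n : ℝ) + 1)) • χ * (slitCalculus hU).y i) (Weyl G i k) := by
  have h := (represents_Tcurv hU hG i k).add
    ((hχ.smul (3 / ((n : ℝ) + 1))).mul (Represents.coord hU i))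
  intro p
  rw [← h p, Weyl]
  ring

lemma represents_Scurv {σ : Vec n → ℝ} {ℓ : smoothFunctions (U ×ˢ slit n)}
    (hℓ : Represents ℓ (fun x _ => Real.log (σ x))) :
    Represents ((slitCalculus hU).divergence g
      - ∑ m, (slitCalculus hU).y m * (slitCalculus hU).X m ℓ) (Scurv G σ) :=
  (Represents.sum fun m => (hG m).pdy hU m).sub
    (Represents.sum fun m => (Represents.coord hU m).mul (hℓ.pdx hU m))

lemma represents_Ghat {σ : Vec n → ℝ} {S : smoothFunctions (U ×ˢ slit n)}
    (hS : Represents S (Scurv G σ)) (i : Fin n) :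
    Represents ((slitCalculus hU).projective g (-((n : ℝ) + 1)⁻¹ • S) i) (Ghat G σ i) := by
  have h := (hG i).add ((hS.smul (-((n : ℝ) + 1)⁻¹)).mul (Represents.coord hU i))
  intro p
  rw [projective, ← h p, Ghat]
  ring

end Slit

/-- Proposition 1.3: expression of the Berwald–Weyl curvature of `(G,dV)` in terms of the
curvatures, the χ-curvature and the S-curvature of `G`, with `|` taken w.r.t. `G`. -/
theorem stmt_0 {n : ℕ} (hn : 2 ≤ n) (U : Set (Vec n)) (hU : IsOpen U) (hUne : U.Nonempty)
    (G : Fin n → Vec n → Vec n → ℝ) (hG : IsSpray U G)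
    (σ : Vec n → ℝ) (hσ : IsVolumeForm U σ) :
    ∀ x ∈ U, ∀ y ∈ slit n, ∀ k : Fin n,
      BWeyl G σ k x y =
        hD G (Ricci G) k x y
          - (1/2) * ∑ m, covD1 G (fun j => pdy (Ricci G) j) k m x y * y m
          - (1/((n : ℝ) + 1)) * ∑ m, covD1 G (chiC G) k m x y * y m
          - (1/((n : ℝ) + 1)) * ∑ m, Weyl G m k x y * pdy (Scurv G σ) m x y := by
  intro x hx y hy k
  set J := slitCalculus hU with hJ
  let g : Fin n → smoothFunctions (U ×ˢ slit n) := fun i => smoothRestrict _ (hG.1 i)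
  have hgG : ∀ i, Represents (g i) (G i) := fun i p => rfl
  have hg : ∀ i, J.euler (g i) = 2 * g i := fun i =>
    euler_of_homogeneous hU (hgG i) (hG.2 i)
  let ℓ : smoothFunctions (U ×ˢ slit n) := smoothRestrict (fun p => Real.log (σ p.1))
    ((hσ.1.comp contDiffOn_fst fun p hp => hp.1).log fun p hp => (hσ.2 _ hp.1).ne')
  have hℓ : Represents ℓ (fun x _ => Real.log (σ x)) := fun p => rfl
  have hVℓ : ∀ i, J.V i ℓ = 0 := fun i => by
    ext p
    rw [← hℓ.pdy hU i p]
    simp [pdy]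
  set S := J.divergence g - ∑ m, J.y m * J.X m ℓ with hSdef
  have hS : Represents S (Scurv G σ) := represents_Scurv hU hgG hℓ
  have hn1 : (n : ℝ) - 1 ≠ 0 := by
    have : (2 : ℝ) ≤ n := by exact_mod_cast hn
    linarith
  have hn2 : (n : ℝ) + 1 ≠ 0 := by positivity
  have hSe : J.euler S = S := by
    have h0 : J.euler ℓ = 0 := by simp [VerticalCalculus.euler, hVℓ]
    rw [hSdef, J.euler_sub, J.euler_divergence hg, J.euler_sum]
    simp only [J.euler_mul, J.euler_X, h0, map_zero, J.euler_y, mul_zero, zero_add,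
      mul_comm (J.X _ ℓ)]
  have hLS : ∀ i, J.eulerLagrange g i S = J.eulerLagrange g i (J.divergence g) := fun i => by
    have hVX : ∀ j, J.V j (∑ m, J.y m * J.X m ℓ) = J.X j ℓ := fun j => by
      simp [map_sum, J.V_y, ← J.X_V, hVℓ]
    have hVXX : ∀ j m, J.V j (J.X m ℓ) = 0 := fun j m => by simp [← J.X_V, hVℓ]
    have hXX : J.X i (∑ m, J.y m * J.X m ℓ) = ∑ m, J.y m * J.X m (J.X i ℓ) := by
      simp [map_sum, J.X_y, J.X_X i]
    simp only [VerticalCalculus.eulerLagrange, hSdef, map_sub, hVX, hXX]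
    rw [J.sprayField_apply g (J.X i ℓ)]
    simp [hVXX]
  set P := -((n : ℝ) + 1)⁻¹ • S with hP
  have hPe : J.euler P = P := by rw [hP, J.euler_smul, hSe]
  have hgP : ∀ i, Represents (J.projective g P i) (Ghat G σ i) := represents_Ghat hU hgG hS
  have hgPe : ∀ i, J.euler (J.projective g P i) = 2 * J.projective g P i := fun i => by
    rw [VerticalCalculus.projective, J.euler_add, J.euler_mul, hg, hPe, J.euler_y]
    ring
  set ρ : smoothFunctions (U ×ˢ slit n) := ((n : ℝ) - 1)⁻¹ • ∑ m, J.riemann g m m with hρ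
  have hρe : J.euler ρ = 2 * ρ := by
    rw [hρ, J.euler_smul, J.euler_trace_riemann hg, mul_smul_comm]
  have hρ' : ((n : ℝ) - 1)⁻¹ • ∑ m, J.riemann (J.projective g P) m m =
      ρ + (P ^ 2 - J.sprayField g P) := by
    have : ((n : smoothFunctions (U ×ˢ slit n)) - 1) * (P ^ 2 - J.sprayField g P) =
        ((n : ℝ) - 1) • (P ^ 2 - J.sprayField g P) := by
      simp [Algebra.smul_def]
    rw [J.trace_riemann_projective hg hPe, smul_add, this, inv_smul_smul₀ hn1]
  have hχ : ∀ i, Represents ((((n : ℝ) + 1) / 2) • J.eulerLagrange g i P) (chiC G i) := fun i => by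
    refine (represents_chiC hU hgG hn hg i).congr ?_
    have : J.eulerLagrange g i P = -((n : ℝ) + 1)⁻¹ • J.eulerLagrange g i S := by
      simp only [VerticalCalculus.eulerLagrange, hP, Derivation.map_smul, smul_sub]
    rw [this, hLS, smul_smul]
    congr 1
    field_simp
  have hleft : Represents _ (BWeyl G σ k) :=
    represents_berwald hU hgP hgPe (represents_Ricci hU hgP) k
  have hright := ((represents_berwald hU hgG hg (represents_Ricci hU hgG) k).sub
    ((represents_sum_covD1 hU hgG hg hχ k).smul (1 / ((n : ℝ) + 1)))).sub
    ((Represents.sum fun m => (represents_Weyl hU hgG (hχ k) m).mul (hS.pdy hU m)).smul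
      (1 / ((n : ℝ) + 1)))
  refine (hleft ⟨(x, y), hx, hy⟩).trans (Eq.trans ?_ (hright ⟨(x, y), hx, hy⟩).symm)
  refine congrFun (congrArg Subtype.val ?_) _
  simp only [← hJ, ← hρ, hρ', J.berwald_projective_ricci hg hPe k hρe]
  have hVP : ∀ m, J.V m P = -((n : ℝ) + 1)⁻¹ • J.V m S := fun m => (J.V m).map_smul _ _
  have hW := J.sum_weyl_mul (g := g) hPe k ρ
    ((3 / ((n : ℝ) + 1)) • (((n : ℝ) + 1) / 2) • J.eulerLagrange g k P) ((1 / 2 : ℝ) • J.V k ρ)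
  have hVS : ∀ w : Fin n → smoothFunctions (U ×ˢ slit n),
      (1 / ((n : ℝ) + 1)) • ∑ m, w m * J.V m S = (-1 : ℝ) • ∑ m, w m * J.V m P := fun w => by
    simp only [hVP, mul_smul_comm, ← Finset.smul_sum, smul_smul]
    congr 1
    ring
  have hc : ∑ l, J.V k (g l) * (((n : ℝ) + 1) / 2) • J.eulerLagrange g l P =
      (((n : ℝ) + 1) / 2) • ∑ l, J.V k (g l) * J.eulerLagrange g l P := by
    simp only [mul_smul_comm, Finset.smul_sum]
  have hc₁ : 1 / ((n : ℝ) + 1) * (((n : ℝ) + 1) / 2) = 1 / 2 := by field_simp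
  have hc₂ : 3 / ((n : ℝ) + 1) * (((n : ℝ) + 1) / 2) = 3 / 2 := by field_simp
  rw [hVS, hW, hc, (J.sprayField g).map_smul, ← smul_sub, smul_smul, smul_smul, hc₁, hc₂]
  clear_value ρ P
  simp only [Algebra.smul_mul_assoc, two_mul, show ∀ f : smoothFunctions (U ×ˢ slit n),
    3 * f = (3 : ℝ) • f from fun f => by simp [ofNat_smul_eq_nsmul], add_mul]
  rw [mul_comm (J.V k P) ρ, mul_comm P (J.V k ρ), mul_comm P (J.eulerLagrange g k P)]
  module

end BerwaldWeyl
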